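/- arXiv:2503.03217 — 3 statements merged into one kernel-verified Lean document; each statement's English description precedes it below -/
import Mathlib

section
/- Let θ : ℝⁿ → ℝ ∪ {+∞} be a polyhedral convex function and (x̄, v̄) ∈ gph ∂θ. Then every q ∈ quad θ(x̄, v̄) satisfies q(w) ≥ δ_{C−C}(w) for all w ∈ ℝⁿ, where C = C_θ(x̄, v̄) is the critical cone; moreover δ_{C−C} itself belongs to quad θ(x̄, v̄). In particular, the indicator of the linear span C − C is the minimal element of the quadratic bundle of θ at x̄ for v̄. -/
/- STATEMENT 3: for a polyhedral convex function θ and (x̄,v̄) ∈ gph ∂θ, every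
member q of the quadratic bundle quad θ(x̄,v̄) dominates the indicator of
C−C (C the critical cone), and δ_{C−C} itself belongs to quad θ(x̄,v̄); hence
δ_{C−C} is the minimal element of the quadratic bundle. -/

open scoped RealInnerProductSpace
open Filter Topology Classical
open scoped Pointwise

noncomputable section

variable {n : ℕ}

def Subdiff (f : EuclideanSpace ℝ (Fin n) → EReal) (x : EuclideanSpace ℝ (Fin n)) :
    Set (EuclideanSpace ℝ (Fin n)) :=
  {v | ∀ y, f x + ((⟪v, y - x⟫ : ℝ) : EReal) ≤ f y}

def ProperFn (f : EuclideanSpace ℝ (Fin n) → EReal) : Prop :=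
  (∀ x, f x ≠ ⊥) ∧ ∃ x, f x ≠ ⊤

/-- Epigraph of an extended-real-valued function. -/
def Epigraph {α : Type*} (f : α → EReal) : Set (α × ℝ) :=
  {p | f p.1 ≤ (p.2 : EReal)}

/-- A polyhedral function: its epigraph is a finite intersection of halfspaces. -/
def IsPolyhedralFn (f : EuclideanSpace ℝ (Fin n) → EReal) : Prop :=
  ∃ (m : ℕ) (A : Fin m → EuclideanSpace ℝ (Fin n)) (a b : Fin m → ℝ),
    Epigraph f = {p | ∀ i, ⟪A i, p.1⟫ + a i * p.2 ≤ b i}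

/-- First subderivative df(x)(w) = liminf_{t↓0, w'→w} [f(x+tw') − f(x)]/t. -/
def SubderivAt (f : EuclideanSpace ℝ (Fin n) → EReal) (x w : EuclideanSpace ℝ (Fin n)) :
    EReal :=
  Filter.liminf
    (fun q : ℝ × EuclideanSpace ℝ (Fin n) =>
      (((1 / q.1 : ℝ)) : EReal) * (f (x + q.1 • q.2) - f x))
    ((𝓝[>] (0 : ℝ)) ×ˢ 𝓝 w)

/-- Second subderivative d²f(x,v)(w). -/
def Sub2At (f : EuclideanSpace ℝ (Fin n) → EReal) (x v w : EuclideanSpace ℝ (Fin n)) :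
    EReal :=
  Filter.liminf
    (fun q : ℝ × EuclideanSpace ℝ (Fin n) =>
      (((2 / q.1 ^ 2 : ℝ)) : EReal) *
        (f (x + q.1 • q.2) - f x - ((q.1 * ⟪v, q.2⟫ : ℝ) : EReal)))
    ((𝓝[>] (0 : ℝ)) ×ˢ 𝓝 w)

/-- Critical cone C_f(x,v) = {w : ⟨v,w⟩ = df(x)(w)}. -/
def CritCone (f : EuclideanSpace ℝ (Fin n) → EReal) (x v : EuclideanSpace ℝ (Fin n)) :
    Set (EuclideanSpace ℝ (Fin n)) :=
  {w | ((⟪v, w⟫ : ℝ) : EReal) = SubderivAt f x w}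

/-- Extended-real-valued indicator function of a set. -/
def indicatorE {α : Type*} (S : Set α) : α → EReal := fun x => if x ∈ S then 0 else ⊤

def OuterLim {α : Type*} [TopologicalSpace α] (C : ℕ → Set α) : Set α :=
  {x | ∃ φ : ℕ → ℕ, StrictMono φ ∧ ∃ u : ℕ → α,
    (∀ k, u k ∈ C (φ k)) ∧ Tendsto u atTop (𝓝 x)}

def InnerLim {α : Type*} [TopologicalSpace α] (C : ℕ → Set α) : Set α :=
  {x | ∃ u : ℕ → α, (∀ k, u k ∈ C k) ∧ Tendsto u atTop (𝓝 x)}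

def KurTendsto {α : Type*} [TopologicalSpace α] (C : ℕ → Set α) (L : Set α) : Prop :=
  InnerLim C = L ∧ OuterLim C = L

/-- Epi-convergence: Painlevé–Kuratowski convergence of the epigraphs. -/
def EpiConv {α : Type*} [TopologicalSpace α] (F : ℕ → α → EReal) (f : α → EReal) : Prop :=
  KurTendsto (fun k => Epigraph (F k)) (Epigraph f)

/-- Generalized quadratic form. -/
def IsGQF (φ : EuclideanSpace ℝ (Fin n) → EReal) : Prop :=
  ∃ (S : Submodule ℝ (EuclideanSpace ℝ (Fin n)))
    (L : S →ₗ[ℝ] EuclideanSpace ℝ (Fin n)),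
    (∀ x y : S, ⟪L x, (y : EuclideanSpace ℝ (Fin n))⟫ =
      ⟪(x : EuclideanSpace ℝ (Fin n)), L y⟫) ∧
    ∀ x : EuclideanSpace ℝ (Fin n),
      φ x = if h : x ∈ S then ((⟪L ⟨x, h⟩, x⟫ : ℝ) : EReal) else ⊤

/-- Quadratic bundle: epi-limits of second subderivatives which are GQFs along
sequences in gph ∂f converging to (x̄,v̄). -/
def QuadBundle (f : EuclideanSpace ℝ (Fin n) → EReal) (x v : EuclideanSpace ℝ (Fin n)) :
    Set (EuclideanSpace ℝ (Fin n) → EReal) :=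
  {q | IsGQF q ∧ ∃ X V : ℕ → EuclideanSpace ℝ (Fin n),
    (∀ k, V k ∈ Subdiff f (X k)) ∧
    (∀ k, IsGQF (Sub2At f (X k) (V k))) ∧
    Tendsto X atTop (𝓝 x) ∧ Tendsto V atTop (𝓝 v) ∧
    EpiConv (fun k => Sub2At f (X k) (V k)) q}

lemma exists_real_eq_of_mem_subdiff {θ : EuclideanSpace ℝ (Fin n) → EReal} (hproper : ProperFn θ)
    {x v : EuclideanSpace ℝ (Fin n)} (hv : v ∈ Subdiff θ x) : ∃ r : ℝ, θ x = r := by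
  obtain ⟨h1, y, hy⟩ := hproper
  have h := hv y
  have hx := h1 x
  induction hθ : θ x with
  | bot => exact absurd hθ hx
  | top =>
    rw [hθ, EReal.top_add_coe] at h
    exact absurd (top_le_iff.mp h) hy
  | coe r => exact ⟨r, rfl⟩

/-- The halfspaces `⟪A i, y⟫ + a i * s ≤ b i` describe the epigraph of `θ`. -/
def EpigraphRep (θ : EuclideanSpace ℝ (Fin n) → EReal) {m : ℕ}
    (A : Fin m → EuclideanSpace ℝ (Fin n)) (a b : Fin m → ℝ) : Prop :=
  ∀ (y : EuclideanSpace ℝ (Fin n)) (s : ℝ), θ y ≤ s ↔ ∀ i, ⟪A i, y⟫ + a i * s ≤ b i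

/-- The critical cone written with the constraints active at `(x, r)`, where `r = θ x`. -/
def activeCone {m : ℕ} (A : Fin m → EuclideanSpace ℝ (Fin n)) (a b : Fin m → ℝ)
    (x v : EuclideanSpace ℝ (Fin n)) (r : ℝ) : Set (EuclideanSpace ℝ (Fin n)) :=
  {w | ∀ i, ⟪A i, x⟫ + a i * r = b i → ⟪A i, w⟫ + a i * ⟪v, w⟫ ≤ 0}

section Polyhedral

variable {θ : EuclideanSpace ℝ (Fin n) → EReal} {m : ℕ}
  {A : Fin m → EuclideanSpace ℝ (Fin n)} {a b : Fin m → ℝ}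

lemma EpigraphRep.coeff_nonpos (hE : EpigraphRep θ A a b) {x : EuclideanSpace ℝ (Fin n)} {r : ℝ}
    (hx : θ x = r) (i : Fin m) : a i ≤ 0 := by
  by_contra! h
  set c := (b i - ⟪A i, x⟫ - a i * r) / a i with hc
  have h0 := (hE x r).mp hx.le i
  have hc0 : 0 ≤ c := div_nonneg (by linarith) h.le
  have h1 := (hE x (r + (c + 1))).mp (by rw [hx]; exact_mod_cast by linarith) i
  have h2 : a i * c = b i - ⟪A i, x⟫ - a i * r := by rw [hc]; field_simp
  nlinarith

lemma EpigraphRep.eventually_ray_le (hE : EpigraphRep θ A a b) {x w : EuclideanSpace ℝ (Fin n)}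
    {r s : ℝ} (hx : θ x = r)
    (hw : ∀ i, ⟪A i, x⟫ + a i * r = b i → ⟪A i, w⟫ + a i * s ≤ 0) :
    ∀ᶠ t in 𝓝[>] (0 : ℝ), θ (x + t • w) ≤ ((r + t * s : ℝ) : EReal) := by
  have key : ∀ i, ∀ᶠ t in 𝓝[>] (0 : ℝ), ⟪A i, x + t • w⟫ + a i * (r + t * s) ≤ b i := by
    intro i
    have h0 := (hE x r).mp hx.le i
    rcases h0.eq_or_lt with h | h
    · filter_upwards [self_mem_nhdsWithin] with t (ht : 0 < t)
      have := hw i h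
      rw [inner_add_right, inner_smul_right]
      nlinarith
    · have hcont : Continuous fun t : ℝ => ⟪A i, x + t • w⟫ + a i * (r + t * s) := by fun_prop
      have := (hcont.tendsto 0).eventually_lt_const (u := b i) (by simpa using h)
      exact (this.filter_mono nhdsWithin_le_nhds).mono fun t ht => le_of_lt ht
  filter_upwards [eventually_all.mpr key] with t ht
  exact (hE _ _).mpr ht

lemma EpigraphRep.exists_growth (hE : EpigraphRep θ A a b) {x v w : EuclideanSpace ℝ (Fin n)}
    {r : ℝ} (hx : θ x = r) (hbot : ∀ y, θ y ≠ ⊥) (hw : w ∉ activeCone A a b x v r) :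
    ∃ c > 0, ∀ᶠ w' in 𝓝 w, ∀ t : ℝ, 0 < t →
      ((r + t * ⟪v, w'⟫ + t * c : ℝ) : EReal) ≤ θ (x + t • w') := by
  simp only [activeCone, Set.mem_ofPred_eq, not_forall, not_le] at hw
  obtain ⟨i, hi, hpos⟩ := hw
  set δ := ⟪A i, w⟫ + a i * ⟪v, w⟫ with hδ
  have ha := hE.coeff_nonpos hx i
  have hcont : Continuous fun w' => ⟪A i, w'⟫ + a i * ⟪v, w'⟫ := by fun_prop
  have hev := (hcont.tendsto w).eventually (Ioi_mem_nhds (a := δ / 2) (by linarith))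
  have hden : 0 < 1 - a i := by linarith
  refine ⟨δ / 2 / (1 - a i), by positivity, ?_⟩
  filter_upwards [hev] with w' hw' t ht
  replace hw' : δ / 2 < ⟪A i, w'⟫ + a i * ⟪v, w'⟫ := hw'
  induction hy : θ (x + t • w') with
  | bot => exact absurd hy (hbot _)
  | top => exact le_top
  | coe s =>
    have h1 := (hE _ s).mp hy.le i
    rw [inner_add_right, inner_smul_right] at h1
    rw [EReal.coe_le_coe_iff]
    by_contra! hlt
    set c := δ / 2 / (1 - a i) with hc
    have hc' : c * (1 - a i) = δ / 2 := by rw [hc]; field_simp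
    have hc0 : 0 < c := by positivity
    have h2 : a i * (r + t * ⟪v, w'⟫ + t * c) ≤ a i * s := mul_le_mul_of_nonpos_left hlt.le ha
    have h3 : t * (δ / 2) < t * (⟪A i, w'⟫ + a i * ⟪v, w'⟫) := mul_lt_mul_of_pos_left hw' ht
    have h4 : t * (c * (1 - a i)) = t * (δ / 2) := by rw [hc']
    nlinarith [mul_pos ht hc0]

lemma coe_mul_le_mul_sub_sub {e : EReal} {r β γ k : ℝ} (hk : 0 < k)
    (h : ((r + β + γ : ℝ) : EReal) ≤ e) :
    ((k * γ : ℝ) : EReal) ≤ (k : EReal) * (e - r - (β : EReal)) := by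
  induction e with
  | bot => simp at h
  | top => simp [EReal.coe_mul_top_of_pos hk]
  | coe s =>
    norm_cast at h ⊢
    exact mul_le_mul_of_nonneg_left (by linarith) hk.le

lemma mul_sub_sub_le_coe {e : EReal} {r β γ k : ℝ} (hk : 0 < k)
    (h : e ≤ ((r + β + γ : ℝ) : EReal)) :
    (k : EReal) * (e - r - (β : EReal)) ≤ ((k * γ : ℝ) : EReal) := by
  induction e with
  | bot => simp [EReal.coe_mul_bot_of_pos hk]
  | top => exact absurd (top_le_iff.mp h) (EReal.coe_ne_top _)
  | coe s =>
    norm_cast at h ⊢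
    exact mul_le_mul_of_nonneg_left (by linarith) hk.le

lemma eventually_fst_pos (w : EuclideanSpace ℝ (Fin n)) :
    ∀ᶠ q in (𝓝[>] (0 : ℝ)) ×ˢ 𝓝 w, 0 < q.1 :=
  Eventually.prod_inl (eventually_mem_nhdsWithin : ∀ᶠ t in 𝓝[>] (0 : ℝ), t ∈ Set.Ioi 0) _

lemma frequently_prod_of_eventually {w : EuclideanSpace ℝ (Fin n)}
    {p : ℝ × EuclideanSpace ℝ (Fin n) → Prop} (h : ∀ᶠ t in 𝓝[>] (0 : ℝ), p (t, w)) :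
    ∃ᶠ q in (𝓝[>] (0 : ℝ)) ×ˢ 𝓝 w, p q :=
  (tendsto_id.prodMk tendsto_const_nhds : Tendsto (fun t : ℝ => (t, w)) (𝓝[>] 0)
    ((𝓝[>] (0 : ℝ)) ×ˢ 𝓝 w)).frequently h.frequently

lemma le_ray_of_mem_subdiff {x v : EuclideanSpace ℝ (Fin n)} {r : ℝ} (hx : θ x = r)
    (hv : v ∈ Subdiff θ x) (t : ℝ) (w : EuclideanSpace ℝ (Fin n)) :
    ((r + t * ⟪v, w⟫ : ℝ) : EReal) ≤ θ (x + t • w) := by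
  have := hv (x + t • w)
  rw [hx, add_sub_cancel_left, inner_smul_right] at this
  exact_mod_cast this

lemma EpigraphRep.sub2At_eq (hE : EpigraphRep θ A a b) (hbot : ∀ y, θ y ≠ ⊥)
    {x v : EuclideanSpace ℝ (Fin n)} {r : ℝ} (hx : θ x = r) (hv : v ∈ Subdiff θ x) :
    Sub2At θ x v = indicatorE (activeCone A a b x v r) := by
  funext w
  unfold Sub2At indicatorE
  rw [hx]
  split_ifs with hw
  · refine le_antisymm (liminf_le_of_frequently_le (frequently_prod_of_eventually ?_))
      (le_liminf_of_le (by isBoundedDefault) ?_)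
    · filter_upwards [hE.eventually_ray_le hx hw, self_mem_nhdsWithin] with t ht (ht0 : 0 < t)
      have := mul_sub_sub_le_coe (γ := 0) (r := r) (β := t * ⟪v, w⟫) (k := 2 / t ^ 2)
        (by positivity) (by simpa using ht)
      simpa using this
    · filter_upwards [eventually_fst_pos w] with q hq
      have := coe_mul_le_mul_sub_sub (γ := 0) (r := r) (β := q.1 * ⟪v, q.2⟫) (k := 2 / q.1 ^ 2)
        (by positivity) (by simpa using le_ray_of_mem_subdiff hx hv q.1 q.2)
      simpa using this
  · obtain ⟨c, hc, hev⟩ := hE.exists_growth hx hbot hw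
    rw [EReal.eq_top_iff_forall_lt]
    intro N
    refine lt_of_lt_of_le (EReal.coe_lt_coe_iff.mpr (lt_add_one N))
      (le_liminf_of_le (by isBoundedDefault) ?_)
    have hlim : Tendsto (fun t : ℝ => 2 * c * t⁻¹) (𝓝[>] 0) atTop :=
      tendsto_inv_nhdsGT_zero.const_mul_atTop (by positivity)
    filter_upwards [eventually_fst_pos w, hev.prod_inr _,
      (hlim.eventually_ge_atTop (N + 1)).prod_inl _] with q hq h1 h2
    refine le_trans ?_ (coe_mul_le_mul_sub_sub (γ := q.1 * c) (by positivity) (h1 q.1 hq))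
    rw [EReal.coe_le_coe_iff]
    refine h2.trans (le_of_eq ?_)
    field_simp

lemma EpigraphRep.critCone_eq (hE : EpigraphRep θ A a b) (hbot : ∀ y, θ y ≠ ⊥)
    {x v : EuclideanSpace ℝ (Fin n)} {r : ℝ} (hx : θ x = r) (hv : v ∈ Subdiff θ x) :
    CritCone θ x v = activeCone A a b x v r := by
  have lower : ∀ (w : EuclideanSpace ℝ (Fin n)) (c : ℝ), (∀ᶠ w' in 𝓝 w, ∀ t : ℝ, 0 < t →
      ((r + t * ⟪v, w'⟫ + t * c : ℝ) : EReal) ≤ θ (x + t • w')) →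
      ((⟪v, w⟫ + c : ℝ) : EReal) ≤ SubderivAt θ x w := by
    intro w c hev
    have hcont : Continuous fun w' => ((⟪v, w'⟫ + c : ℝ) : EReal) :=
      continuous_coe_real_ereal.comp (by fun_prop)
    have hlim : Tendsto (fun q : ℝ × EuclideanSpace ℝ (Fin n) => ((⟪v, q.2⟫ + c : ℝ) : EReal))
        ((𝓝[>] (0 : ℝ)) ×ˢ 𝓝 w) (𝓝 ((⟪v, w⟫ + c : ℝ) : EReal)) :=
      (hcont.tendsto w).comp tendsto_snd
    rw [← hlim.liminf_eq]
    refine liminf_le_liminf ?_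
    filter_upwards [eventually_fst_pos w, hev.prod_inr _] with q hq h1
    have := coe_mul_le_mul_sub_sub (e := θ (x + q.1 • q.2)) (r := r) (β := 0)
      (γ := q.1 * (⟪v, q.2⟫ + c)) (k := 1 / q.1) (by positivity)
      (le_trans (le_of_eq (by congr 1; ring)) (h1 q.1 hq))
    rw [hx]
    simpa [← mul_assoc, hq.ne'] using this
  ext w
  constructor
  · intro hw
    by_contra hnot
    obtain ⟨c, hc, hev⟩ := hE.exists_growth hx hbot hnot
    have h1 := lower w c hev
    rw [← (show _ = SubderivAt θ x w from hw), EReal.coe_le_coe_iff] at h1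
    linarith
  · intro hw
    refine le_antisymm ?_ (liminf_le_of_frequently_le (frequently_prod_of_eventually ?_))
    · have := lower w 0 (Eventually.of_forall fun w' t _ => by simpa using le_ray_of_mem_subdiff hx hv t w')
      simpa using this
    · filter_upwards [hE.eventually_ray_le hx hw, self_mem_nhdsWithin] with t ht (ht0 : 0 < t)
      have := mul_sub_sub_le_coe (γ := t * ⟪v, w⟫) (r := r) (β := 0) (k := 1 / t)
        (by positivity) (by simpa using ht)
      rw [hx]
      simpa [← mul_assoc, ht0.ne'] using this

/-- Subgradients at a point depend only on the constraints active there. -/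
lemma EpigraphRep.mem_subdiff_iff (hE : EpigraphRep θ A a b) (hbot : ∀ y, θ y ≠ ⊥)
    {y u : EuclideanSpace ℝ (Fin n)} {r : ℝ} (hy : θ y = r) :
    u ∈ Subdiff θ y ↔ ∀ (w : EuclideanSpace ℝ (Fin n)) (s : ℝ),
      (∀ i, ⟪A i, y⟫ + a i * r = b i → ⟪A i, w⟫ + a i * s ≤ 0) → ⟪u, w⟫ ≤ s := by
  constructor
  · intro hu w s hw
    obtain ⟨t, ht, ht0⟩ :=
      ((hE.eventually_ray_le hy hw).and self_mem_nhdsWithin).exists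
    have h := (le_ray_of_mem_subdiff hy hu t w).trans ht
    rw [EReal.coe_le_coe_iff] at h
    exact le_of_mul_le_mul_left (by linarith) (show 0 < t from ht0)
  · intro h z
    rw [hy]
    induction hz : θ z with
    | bot => exact absurd hz (hbot _)
    | top => exact le_top
    | coe s =>
      have := h (z - y) (s - r) fun i hi => by
        have := (hE z s).mp hz.le i
        rw [inner_sub_right]
        linarith
      exact_mod_cast by linarith

/-- Subgradients sufficiently close to `v` are subgradients only where `v` is one. -/
lemma EpigraphRep.eventually_subdiff_imp (hE : EpigraphRep θ A a b) (hproper : ProperFn θ)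
    (v : EuclideanSpace ℝ (Fin n)) :
    ∀ᶠ u in 𝓝 v, ∀ y, u ∈ Subdiff θ y → v ∈ Subdiff θ y := by
  let E : Set (Fin m) → Set (EuclideanSpace ℝ (Fin n)) := fun J =>
    {u | ∀ (w : EuclideanSpace ℝ (Fin n)) (s : ℝ),
      (∀ i ∈ J, ⟪A i, w⟫ + a i * s ≤ 0) → ⟪u, w⟫ ≤ s}
  have hclosed : ∀ J, IsClosed (E J) := by
    intro J
    simp only [E, Set.ofPred_forall]
    exact isClosed_iInter fun w => isClosed_iInter fun s => isClosed_iInter fun _ =>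
      isClosed_le (by fun_prop) continuous_const
  have hev : ∀ J, ∀ᶠ u in 𝓝 v, u ∈ E J → v ∈ E J := by
    intro J
    by_cases h : v ∈ E J
    · exact Eventually.of_forall fun _ _ => h
    · filter_upwards [(hclosed J).isOpen_compl.mem_nhds h] with u hu hu'
      exact absurd hu' hu
  filter_upwards [eventually_all.mpr hev] with u hu y hy
  obtain ⟨r, hr⟩ := exists_real_eq_of_mem_subdiff hproper hy
  exact (hE.mem_subdiff_iff hproper.1 hr).mpr (hu {i | ⟪A i, y⟫ + a i * r = b i}
    ((hE.mem_subdiff_iff hproper.1 hr).mp hy))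

lemma EpigraphRep.sub_mem_activeCone (hE : EpigraphRep θ A a b) (hproper : ProperFn θ)
    {x y v : EuclideanSpace ℝ (Fin n)} {r : ℝ} (hx : θ x = r)
    (hv : v ∈ Subdiff θ x) (hy : v ∈ Subdiff θ y) : y - x ∈ activeCone A a b x v r := by
  obtain ⟨s, hs⟩ := exists_real_eq_of_mem_subdiff hproper hy
  intro i hi
  have h1 := hv y
  have h2 := hy x
  rw [hx, hs] at h1 h2
  norm_cast at h1 h2
  have h3 : ⟪v, x - y⟫ = -⟪v, y - x⟫ := by rw [← neg_sub, inner_neg_right]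
  have h4 : ⟪v, y - x⟫ = s - r := by linarith
  have h5 := (hE y s).mp hs.le i
  rw [h4, inner_sub_right]
  linarith

/-- Moving from `x` in a critical direction keeps `v` a subgradient for a short time. -/
lemma EpigraphRep.eventually_mem_subdiff (hE : EpigraphRep θ A a b)
    {x v w : EuclideanSpace ℝ (Fin n)} {r : ℝ} (hx : θ x = r) (hv : v ∈ Subdiff θ x)
    (hw : w ∈ activeCone A a b x v r) :
    ∀ᶠ t in 𝓝[>] (0 : ℝ), θ (x + t • w) = ((r + t * ⟪v, w⟫ : ℝ) : EReal) ∧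
      v ∈ Subdiff θ (x + t • w) := by
  filter_upwards [hE.eventually_ray_le hx hw] with t ht
  have heq := le_antisymm ht (le_ray_of_mem_subdiff hx hv t w)
  refine ⟨heq, fun y => ?_⟩
  refine le_trans (le_of_eq ?_) (hv y)
  rw [heq, hx]
  norm_cast
  rw [inner_sub_right, inner_sub_right, inner_add_right, inner_smul_right]
  ring

lemma activeCone_smul {x v w : EuclideanSpace ℝ (Fin n)} {r t : ℝ} (ht : 0 ≤ t)
    (hw : w ∈ activeCone A a b x v r) : t • w ∈ activeCone A a b x v r := by
  intro i hi
  rw [inner_smul_right, inner_smul_right]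
  nlinarith [hw i hi]

lemma activeCone_add {x v w z : EuclideanSpace ℝ (Fin n)} {r : ℝ}
    (hw : w ∈ activeCone A a b x v r) (hz : z ∈ activeCone A a b x v r) :
    w + z ∈ activeCone A a b x v r := by
  intro i hi
  rw [inner_add_right, inner_add_right]
  linarith [hw i hi, hz i hi]

lemma zero_mem_activeCone {x v : EuclideanSpace ℝ (Fin n)} {r : ℝ} :
    (0 : EuclideanSpace ℝ (Fin n)) ∈ activeCone A a b x v r := by
  intro i _
  simp

/-- The subspace `C - C` spanned by the critical cone `C`. -/
def activeSpan (A : Fin m → EuclideanSpace ℝ (Fin n)) (a b : Fin m → ℝ)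
    (x v : EuclideanSpace ℝ (Fin n)) (r : ℝ) : Submodule ℝ (EuclideanSpace ℝ (Fin n)) where
  carrier := activeCone A a b x v r - activeCone A a b x v r
  zero_mem' := ⟨0, zero_mem_activeCone, 0, zero_mem_activeCone, sub_zero 0⟩
  add_mem' := by
    rintro _ _ ⟨p, hp, q, hq, rfl⟩ ⟨p', hp', q', hq', rfl⟩
    exact ⟨p + p', activeCone_add hp hp', q + q', activeCone_add hq hq', by
      simp only; abel⟩
  smul_mem' := by
    rintro c _ ⟨p, hp, q, hq, rfl⟩
    rcases le_total 0 c with hc | hc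
    · exact ⟨c • p, activeCone_smul hc hp, c • q, activeCone_smul hc hq, (smul_sub c p q).symm⟩
    · exact ⟨(-c) • q, activeCone_smul (by linarith) hq, (-c) • p,
        activeCone_smul (by linarith) hp, by simp only [neg_smul, smul_sub]; abel⟩

lemma mem_activeSpan {x v w : EuclideanSpace ℝ (Fin n)} {r : ℝ} :
    w ∈ activeSpan A a b x v r ↔ w ∈ activeCone A a b x v r - activeCone A a b x v r :=
  Iff.rfl

/-- Critical cones at nearby points of the graph of `∂θ` lie in the span of the reference cone. -/
lemma EpigraphRep.activeCone_subset_activeSpan (hE : EpigraphRep θ A a b) (hproper : ProperFn θ)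
    {x v y u : EuclideanSpace ℝ (Fin n)} {r s : ℝ} (hx : θ x = r) (hv : v ∈ Subdiff θ x)
    (hy : θ y = s) (hu : u ∈ Subdiff θ y) (himp : ∀ z, u ∈ Subdiff θ z → v ∈ Subdiff θ z) :
    activeCone A a b y u s ⊆ activeSpan A a b x v r := by
  intro w hw
  obtain ⟨t, ⟨-, ht⟩, ht0⟩ := ((hE.eventually_mem_subdiff hy hu hw).and self_mem_nhdsWithin).exists
  have ht0 : 0 < t := ht0
  have h1 := hE.sub_mem_activeCone hproper hx hv (himp _ ht)
  have h2 := hE.sub_mem_activeCone hproper hx hv (himp _ hu)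
  have h3 : t • w ∈ activeSpan A a b x v r :=
    mem_activeSpan.mpr ⟨_, h1, _, h2, by simp only; abel⟩
  exact ((activeSpan A a b x v r).smul_mem_iff ht0.ne').mp h3

/-- A critical direction at which every constraint not vanishing identically on the critical cone
is slack. -/
lemma exists_relInterior_activeCone (x v : EuclideanSpace ℝ (Fin n)) (r : ℝ) :
    ∃ w₀ ∈ activeCone A a b x v r, ∀ i, ⟪A i, x⟫ + a i * r = b i →
      ⟪A i, w₀⟫ + a i * ⟪v, w₀⟫ = 0 →
      ∀ w ∈ activeCone A a b x v r, ⟪A i, w⟫ + a i * ⟪v, w⟫ = 0 := by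
  have h : ∀ i, ∃ z ∈ activeCone A a b x v r, ⟪A i, x⟫ + a i * r = b i →
      ⟪A i, z⟫ + a i * ⟪v, z⟫ = 0 →
      ∀ w ∈ activeCone A a b x v r, ⟪A i, w⟫ + a i * ⟪v, w⟫ = 0 := by
    intro i
    by_cases hall : ∀ w ∈ activeCone A a b x v r, ⟪A i, w⟫ + a i * ⟪v, w⟫ = 0
    · exact ⟨0, zero_mem_activeCone, fun _ _ => hall⟩
    · push Not at hall
      obtain ⟨z, hz, hne⟩ := hall
      exact ⟨z, hz, fun _ h0 => absurd h0 hne⟩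
  choose z hz hzi using h
  have hsum : ∀ i, ⟪A i, ∑ j, z j⟫ + a i * ⟪v, ∑ j, z j⟫ =
      ∑ j, (⟪A i, z j⟫ + a i * ⟪v, z j⟫) := fun i => by
    rw [inner_sum, inner_sum, Finset.mul_sum, Finset.sum_add_distrib]
  refine ⟨∑ j, z j, fun i hi => ?_, fun i hi h0 => hzi i hi ?_⟩
  · rw [hsum]
    exact Finset.sum_nonpos fun j _ => hz j i hi
  · rw [hsum] at h0
    exact (Finset.sum_eq_zero_iff_of_nonpos fun j _ => hz j i hi).mp h0 i (Finset.mem_univ i)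

lemma EpigraphRep.eventually_activeCone_eq (hE : EpigraphRep θ A a b) (hproper : ProperFn θ)
    {x v : EuclideanSpace ℝ (Fin n)} {r : ℝ} (hx : θ x = r) (hv : v ∈ Subdiff θ x) :
    ∃ w₀, ∀ᶠ t in 𝓝[>] (0 : ℝ), v ∈ Subdiff θ (x + t • w₀) ∧
      Sub2At θ (x + t • w₀) v = indicatorE (activeSpan A a b x v r : Set _) := by
  obtain ⟨w₀, hw₀, hmin⟩ := exists_relInterior_activeCone (A := A) (a := a) (b := b) x v r
  have hslack : ∀ i, ∀ᶠ t in 𝓝[>] (0 : ℝ),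
      ⟪A i, x + t • w₀⟫ + a i * (r + t * ⟪v, w₀⟫) = b i → ⟪A i, x⟫ + a i * r = b i := by
    intro i
    rcases ((hE x r).mp hx.le i).eq_or_lt with h | h
    · exact Eventually.of_forall fun _ _ => h
    · have hcont : Continuous fun t : ℝ => ⟪A i, x + t • w₀⟫ + a i * (r + t * ⟪v, w₀⟫) := by
        fun_prop
      have := (hcont.tendsto 0).eventually_lt_const (u := b i) (by simpa using h)
      exact (this.filter_mono nhdsWithin_le_nhds).mono fun t ht ht' => absurd ht' (ne_of_lt ht)
  refine ⟨w₀, ?_⟩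
  filter_upwards [hE.eventually_mem_subdiff hx hv hw₀, eventually_all.mpr hslack,
    self_mem_nhdsWithin] with t ⟨hval, hsub⟩ hact ht0
  have ht0 : 0 < t := ht0
  refine ⟨hsub, ?_⟩
  rw [hE.sub2At_eq hproper.1 hval hsub]
  congr 1
  refine Set.Subset.antisymm
    (hE.activeCone_subset_activeSpan hproper hx hv hval hsub fun _ => id) ?_
  rintro _ ⟨p, hp, q, hq, rfl⟩ i hi
  have hi' := hact i hi
  have h0 : ⟪A i, w₀⟫ + a i * ⟪v, w₀⟫ = 0 := by
    rw [inner_add_right, inner_smul_right] at hi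
    have : t * (⟪A i, w₀⟫ + a i * ⟪v, w₀⟫) = 0 := by linarith
    exact (mul_eq_zero.mp this).resolve_left ht0.ne'
  have hp0 := hmin i hi' h0 p hp
  have hq0 := hmin i hi' h0 q hq
  simp only [inner_sub_right]
  linarith

end Polyhedral

lemma isGQF_indicatorE (S : Submodule ℝ (EuclideanSpace ℝ (Fin n))) :
    IsGQF (indicatorE (S : Set (EuclideanSpace ℝ (Fin n)))) := by
  refine ⟨S, 0, by simp, fun x => ?_⟩
  by_cases hx : x ∈ S <;> simp [indicatorE, hx]

lemma indicatorE_le_coe_iff {α : Type*} {S : Set α} {w : α} {r : ℝ} :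
    indicatorE S w ≤ r ↔ w ∈ S ∧ 0 ≤ r := by
  by_cases hw : w ∈ S <;> simp [indicatorE, hw]

lemma isClosed_epigraph_indicatorE (S : Submodule ℝ (EuclideanSpace ℝ (Fin n))) :
    IsClosed (Epigraph (indicatorE (S : Set (EuclideanSpace ℝ (Fin n))))) := by
  have : Epigraph (indicatorE (S : Set (EuclideanSpace ℝ (Fin n)))) =
      (S : Set (EuclideanSpace ℝ (Fin n))) ×ˢ Set.Ici (0 : ℝ) := by
    ext p
    exact indicatorE_le_coe_iff
  rw [this]
  exact S.closed_of_finiteDimensional.prod isClosed_Ici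

lemma kurTendsto_const {α : Type*} [TopologicalSpace α] {L : Set α} (hL : IsClosed L) :
    KurTendsto (fun _ => L) L :=
  ⟨Set.Subset.antisymm
      (fun _ ⟨_, hu, hlim⟩ => hL.mem_of_tendsto hlim (Eventually.of_forall hu))
      (fun x hx => ⟨fun _ => x, fun _ => hx, tendsto_const_nhds⟩),
    Set.Subset.antisymm
      (fun _ ⟨_, _, _, hu, hlim⟩ => hL.mem_of_tendsto hlim (Eventually.of_forall hu))
      (fun x hx => ⟨id, strictMono_id, fun _ => x, fun _ => hx, tendsto_const_nhds⟩)⟩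

theorem statement3 {n : ℕ} (θ : EuclideanSpace ℝ (Fin n) → EReal)
    (hpoly : IsPolyhedralFn θ) (hproper : ProperFn θ)
    (x v : EuclideanSpace ℝ (Fin n)) (hv : v ∈ Subdiff θ x) :
    (∀ q ∈ QuadBundle θ x v, ∀ w,
      indicatorE (CritCone θ x v - CritCone θ x v) w ≤ q w) ∧
    indicatorE (CritCone θ x v - CritCone θ x v) ∈ QuadBundle θ x v := by
  obtain ⟨m, A, a, b, hepi⟩ := hpoly
  have hE : EpigraphRep θ A a b := fun y s => Set.ext_iff.mp hepi (y, s)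
  obtain ⟨r, hx⟩ := exists_real_eq_of_mem_subdiff hproper hv
  have hC : CritCone θ x v - CritCone θ x v = (activeSpan A a b x v r : Set _) := by
    rw [hE.critCone_eq hproper.1 hx hv]
    rfl
  rw [hC]
  constructor
  · rintro q ⟨-, X, V, hsub, -, -, hV, hinner, -⟩ w
    refine EReal.le_of_forall_lt_iff_le.mp fun s hs => ?_
    have hmem : (w, s) ∈ Epigraph q := hs.le
    rw [← hinner] at hmem
    obtain ⟨p, hp, hlim⟩ := hmem
    refine (isClosed_epigraph_indicatorE (activeSpan A a b x v r)).mem_of_tendsto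
      (x := (w, s)) hlim ?_
    filter_upwards [hV.eventually (hE.eventually_subdiff_imp hproper v)] with k hk
    obtain ⟨rk, hrk⟩ := exists_real_eq_of_mem_subdiff hproper (hsub k)
    have hpk : Sub2At θ (X k) (V k) (p k).1 ≤ (p k).2 := hp k
    rw [hE.sub2At_eq hproper.1 hrk (hsub k), indicatorE_le_coe_iff] at hpk
    exact indicatorE_le_coe_iff.mpr
      ⟨hE.activeCone_subset_activeSpan hproper hx hv hrk (hsub k) hk hpk.1, hpk.2⟩
  · obtain ⟨w₀, hev⟩ := hE.eventually_activeCone_eq hproper hx hv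
    have hseq : Tendsto (fun k : ℕ => 1 / ((k : ℝ) + 1)) atTop (𝓝[>] 0) :=
      tendsto_nhdsWithin_iff.mpr ⟨tendsto_one_div_add_atTop_nhds_zero_nat,
        Eventually.of_forall fun k => Set.mem_Ioi.mpr (by positivity)⟩
    obtain ⟨N, hN⟩ := eventually_atTop.mp (hseq.eventually hev)
    have hlim : Tendsto (fun k : ℕ => 1 / (((k + N : ℕ) : ℝ) + 1)) atTop (𝓝 0) :=
      tendsto_one_div_add_atTop_nhds_zero_nat.comp (tendsto_add_atTop_nat N)
    have heq := fun k : ℕ => (hN (k + N) (Nat.le_add_left N k)).2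
    refine ⟨isGQF_indicatorE _, fun k => x + (1 / (((k + N : ℕ) : ℝ) + 1)) • w₀, fun _ => v,
      fun k => (hN (k + N) (Nat.le_add_left N k)).1, fun k => ?_, ?_, tendsto_const_nhds, ?_⟩
    · rw [heq k]
      exact isGQF_indicatorE _
    · simpa using (hlim.smul_const w₀).const_add x
    · unfold EpiConv
      simp only [heq]
      exact kurTendsto_const (isClosed_epigraph_indicatorE _)

end
end

section
/- Fan's trace inequality with equality case: for symmetric matrices A, B ∈ Sᵐ, ⟨A, B⟩ ≤ ⟨λ(A), λ(B)⟩ where λ lists eigenvalues in nonincreasing order, and equality holds if and only if A and B have a simultaneous ordered spectral decomposition, i.e., there exists an orthogonal Q with A = Q Diag(λ(A)) Qᵀ and B = Q Diag(λ(B)) Qᵀ. -/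
/- STATEMENT 10: Fan's trace inequality with equality case: for symmetric A, B,
trace(AB) ≤ ⟨λ(A), λ(B)⟩, with equality iff A and B have a simultaneous ordered
spectral decomposition. -/

open Classical Matrix

noncomputable section

abbrev Mat (n : ℕ) := Matrix (Fin n) (Fin n) ℝ

/-- Eigenvalues in nonincreasing order (junk value if not symmetric). -/
noncomputable def eigs {m : ℕ} (A : Mat m) : Fin m → ℝ :=
  if h : A.IsHermitian then (fun i => h.eigenvalues (Tuple.sort h.eigenvalues i.rev)) else 0

theorem eigs_antitone {m : ℕ} {A : Mat m} (hA : A.IsHermitian) : Antitone (eigs A) := by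
  intro i j hij
  simp only [eigs, dif_pos hA]
  exact Tuple.monotone_sort hA.eigenvalues (Fin.rev_le_rev.mpr hij)

theorem exists_ordered_spectral_decomposition {m : ℕ} {A : Mat m} (hA : A.IsHermitian) :
    ∃ Q : Mat m, Q * Qᵀ = 1 ∧ A = Q * diagonal (eigs A) * Qᵀ := by
  let e : Fin m ≃ Fin m := Fin.revPerm.trans (Tuple.sort hA.eigenvalues)
  let U : Mat m := hA.eigenvectorUnitary
  have hU : U * Uᵀ = 1 := by
    have := Unitary.coe_mul_star_self hA.eigenvectorUnitary
    rwa [Unitary.coe_star, star_eq_conjTranspose,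
      conjTranspose_eq_transpose_of_trivial] at this
  have hAU : A = U * diagonal hA.eigenvalues * Uᵀ := by
    have := hA.spectral_theorem
    rw [Unitary.conjStarAlgAut_apply, star_eq_conjTranspose,
      conjTranspose_eq_transpose_of_trivial] at this
    exact this
  have he : diagonal (eigs A) = (diagonal hA.eigenvalues).submatrix e e := by
    rw [submatrix_diagonal_equiv]
    simp only [eigs, dif_pos hA]
    rfl
  refine ⟨U.submatrix id e, ?_, ?_⟩
  · rw [transpose_submatrix, submatrix_mul_equiv, hU, submatrix_id_id]
  · rw [he, transpose_submatrix, submatrix_mul_equiv, submatrix_mul_equiv, submatrix_id_id]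
    exact hAU

theorem sum_mul_doublyStochastic_le {m : ℕ} {a b : Fin m → ℝ} (ha : Antitone a)
    (hb : Antitone b) {S : Mat m} (hS : S ∈ doublyStochastic ℝ (Fin m)) :
    ∑ i, ∑ j, a i * S i j * b j ≤ ∑ i, a i * b i := by
  obtain ⟨w, hw, hw1, rfl⟩ := exists_eq_sum_perm_of_mem_doublyStochastic hS
  have hperm (σ : Equiv.Perm (Fin m)) :
      ∑ i, ∑ j, a i * σ.permMatrix ℝ i j * b j = ∑ i, a i * b (σ i) := by
    simp [Equiv.Perm.permMatrix, PEquiv.toMatrix_apply]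
  calc _ = ∑ σ, w σ * ∑ i, ∑ j, a i * σ.permMatrix ℝ i j * b j := by
        simp only [Matrix.sum_apply, Matrix.smul_apply, smul_eq_mul, Finset.mul_sum, Finset.sum_mul]
        rw [Finset.sum_comm (s := Finset.univ (α := Equiv.Perm (Fin m)))]
        refine Finset.sum_congr rfl fun i _ => ?_
        rw [Finset.sum_comm (s := Finset.univ (α := Equiv.Perm (Fin m)))]
        refine Finset.sum_congr rfl fun j _ => Finset.sum_congr rfl fun σ _ => ?_
        ring
    _ ≤ ∑ σ, w σ * ∑ i, a i * b i := by
        refine Finset.sum_le_sum fun σ _ => mul_le_mul_of_nonneg_left ?_ (hw σ)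
        rw [hperm]
        exact (ha.monovary hb).sum_mul_comp_perm_le_sum_mul
    _ = _ := by rw [← Finset.sum_mul, hw1, one_mul]

theorem map_sq_mem_doublyStochastic {m : ℕ} {W : Mat m} (hW : W * Wᵀ = 1) :
    W.map (· ^ 2) ∈ doublyStochastic ℝ (Fin m) := by
  have hW' : Wᵀ * W = 1 := mul_eq_one_comm.mp hW
  rw [mem_doublyStochastic_iff_sum]
  refine ⟨fun i j => sq_nonneg _, fun i => ?_, fun j => ?_⟩
  · have := congrFun₂ hW i i
    simpa [mul_apply, sq] using this
  · have := congrFun₂ hW' j j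
    simpa [mul_apply, sq] using this

theorem trace_diagonal_conj_mul_diagonal_conj_le {m : ℕ} {a b : Fin m → ℝ} (ha : Antitone a)
    (hb : Antitone b) {P Q : Mat m} (hP : P * Pᵀ = 1) (hQ : Q * Qᵀ = 1) :
    ((P * diagonal a * Pᵀ) * (Q * diagonal b * Qᵀ)).trace ≤ ∑ i, a i * b i := by
  have hP' : Pᵀ * P = 1 := mul_eq_one_comm.mp hP
  have hW : (Pᵀ * Q) * (Pᵀ * Q)ᵀ = 1 := by
    rw [transpose_mul, transpose_transpose, Matrix.mul_assoc, ← Matrix.mul_assoc Q, hQ,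
      Matrix.one_mul, hP']
  refine le_of_eq_of_le ?_
    (sum_mul_doublyStochastic_le ha hb (map_sq_mem_doublyStochastic hW))
  have : ((P * diagonal a * Pᵀ) * (Q * diagonal b * Qᵀ)).trace =
      ((diagonal a * (Pᵀ * Q) * diagonal b) * (Pᵀ * Q)ᵀ).trace := by
    rw [transpose_mul, transpose_transpose, Matrix.mul_assoc P, Matrix.mul_assoc P, trace_mul_comm]
    simp only [Matrix.mul_assoc]
  rw [this, trace]
  refine Finset.sum_congr rfl fun i _ => ?_
  rw [diag_apply, mul_apply]
  refine Finset.sum_congr rfl fun j _ => ?_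
  rw [mul_diagonal, diagonal_mul, transpose_apply, map_apply]
  ring

theorem trace_diagonal_conj_mul_diagonal_conj {m : ℕ} (a b : Fin m → ℝ) {Q : Mat m}
    (hQ : Q * Qᵀ = 1) :
    ((Q * diagonal a * Qᵀ) * (Q * diagonal b * Qᵀ)).trace = ∑ i, a i * b i := by
  have hQ' : Qᵀ * Q = 1 := mul_eq_one_comm.mp hQ
  have : (Q * diagonal a * Qᵀ) * (Q * diagonal b * Qᵀ) =
      Q * (diagonal (fun i => a i * b i) * Qᵀ) := by
    rw [← diagonal_mul_diagonal]
    simp only [Matrix.mul_assoc]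
    rw [← Matrix.mul_assoc Qᵀ Q, hQ', Matrix.one_mul]
  rw [this, trace_mul_comm, Matrix.mul_assoc, hQ', Matrix.mul_one, trace_diagonal]

theorem trace_mul_diagonal_conj_le {m : ℕ} {A : Mat m} (hA : A.IsHermitian) {b : Fin m → ℝ}
    (hb : Antitone b) {Q : Mat m} (hQ : Q * Qᵀ = 1) :
    (A * (Q * diagonal b * Qᵀ)).trace ≤ ∑ i, eigs A i * b i := by
  obtain ⟨P, hP, h⟩ := exists_ordered_spectral_decomposition hA
  conv_lhs => rw [h]
  exact trace_diagonal_conj_mul_diagonal_conj_le (eigs_antitone hA) hb hP hQ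

theorem trace_mul_self_eq_sum_eigs {m : ℕ} {A : Mat m} (hA : A.IsHermitian) :
    (A * A).trace = ∑ i, eigs A i * eigs A i := by
  obtain ⟨P, hP, h⟩ := exists_ordered_spectral_decomposition hA
  conv_lhs => rw [h]
  exact trace_diagonal_conj_mul_diagonal_conj _ _ hP

theorem trace_mul_le_sum_eigs {m : ℕ} {A B : Mat m} (hA : A.IsHermitian) (hB : B.IsHermitian) :
    (A * B).trace ≤ ∑ i, eigs A i * eigs B i := by
  obtain ⟨Q, hQ, h⟩ := exists_ordered_spectral_decomposition hB
  conv_lhs => rw [h]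
  exact trace_mul_diagonal_conj_le hA (eigs_antitone hB) hQ

/-- In the equality case of Fan's inequality, ordered eigenvalues are additive. -/
theorem eigs_add_of_trace_mul_eq {m : ℕ} {A B : Mat m} (hA : A.IsHermitian)
    (hB : B.IsHermitian) (h : (A * B).trace = ∑ i, eigs A i * eigs B i) :
    eigs (A + B) = eigs A + eigs B := by
  have hC := hA.add hB
  have hAC := trace_mul_le_sum_eigs hA hC
  have hBC := trace_mul_le_sum_eigs hB hC
  have hAA := trace_mul_self_eq_sum_eigs hA
  have hBB := trace_mul_self_eq_sum_eigs hB
  have hCC := trace_mul_self_eq_sum_eigs hC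
  have hBA := trace_mul_comm A B
  have hzero : ∑ i, (eigs (A + B) i - (eigs A i + eigs B i)) ^ 2 ≤ 0 := by
    have : ∑ i, (eigs (A + B) i - (eigs A i + eigs B i)) ^ 2 =
        ∑ i, eigs (A + B) i * eigs (A + B) i + ∑ i, eigs A i * eigs A i
          + ∑ i, eigs B i * eigs B i + 2 * ∑ i, eigs A i * eigs B i
          - 2 * ∑ i, eigs A i * eigs (A + B) i - 2 * ∑ i, eigs B i * eigs (A + B) i := by
      simp only [Finset.mul_sum, ← Finset.sum_add_distrib, ← Finset.sum_sub_distrib]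
      exact Finset.sum_congr rfl fun i _ => by ring
    rw [this]
    simp only [Matrix.mul_add, Matrix.add_mul, trace_add] at hAC hBC hCC
    linarith
  have hsum := (Finset.sum_eq_zero_iff_of_nonneg fun i _ => sq_nonneg _).mp
    (le_antisymm hzero (Finset.sum_nonneg fun i _ => sq_nonneg _))
  funext i
  exact sub_eq_zero.mp (pow_eq_zero_iff two_ne_zero |>.mp (hsum i (Finset.mem_univ i)))

theorem eq_diagonal_conj_of_trace_mul_eq {m : ℕ} {A Q : Mat m} (hA : A.IsHermitian)
    (hQ : Q * Qᵀ = 1)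
    (h : (A * (Q * diagonal (eigs A) * Qᵀ)).trace = ∑ i, eigs A i * eigs A i) :
    A = Q * diagonal (eigs A) * Qᵀ := by
  have hAA := trace_mul_self_eq_sum_eigs hA
  have hMM := trace_diagonal_conj_mul_diagonal_conj (eigs A) (eigs A) hQ
  have hMt : (Q * diagonal (eigs A) * Qᵀ)ᵀ = Q * diagonal (eigs A) * Qᵀ := by
    simp [Matrix.mul_assoc]
  set M := Q * diagonal (eigs A) * Qᵀ
  have hAt : Aᵀ = A := hA
  have hMA := trace_mul_comm A M
  have h0 : ((A - M)ᴴ * (A - M)).trace = 0 := by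
    rw [conjTranspose_eq_transpose_of_trivial, transpose_sub, hAt, hMt]
    simp only [Matrix.mul_sub, Matrix.sub_mul, trace_sub]
    linarith
  exact sub_eq_zero.mp (trace_conjTranspose_mul_self_eq_zero_iff.mp h0)

theorem statement10 {m : ℕ} (A B : Mat m) (hA : A.IsHermitian) (hB : B.IsHermitian) :
    (A * B).trace ≤ ∑ i, eigs A i * eigs B i ∧
    ((A * B).trace = ∑ i, eigs A i * eigs B i ↔
      ∃ Q : Mat m, Q * Qᵀ = 1 ∧
        A = Q * Matrix.diagonal (eigs A) * Qᵀ ∧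
        B = Q * Matrix.diagonal (eigs B) * Qᵀ) := by
  refine ⟨trace_mul_le_sum_eigs hA hB, fun h => ?_, ?_⟩
  · obtain ⟨Q, hQ, hC⟩ := exists_ordered_spectral_decomposition (hA.add hB)
    rw [eigs_add_of_trace_mul_eq hA hB h,
      show diagonal (eigs A + eigs B) = diagonal (eigs A) + diagonal (eigs B) from
        (diagonal_add _ _).symm, Matrix.mul_add, Matrix.add_mul] at hC
    have hAC := congrArg (fun X => (A * X).trace) hC
    simp only [Matrix.mul_add, trace_add] at hAC
    have hAA := trace_mul_self_eq_sum_eigs hA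
    have h₁ := trace_mul_diagonal_conj_le hA (eigs_antitone hA) hQ
    have h₂ := trace_mul_diagonal_conj_le hA (eigs_antitone hB) hQ
    have hAQ := eq_diagonal_conj_of_trace_mul_eq hA hQ (by linarith)
    refine ⟨Q, hQ, hAQ, ?_⟩
    rw [← hAQ] at hC
    exact add_left_cancel hC
  · rintro ⟨Q, hQ, hAQ, hBQ⟩
    conv_lhs => rw [hAQ, hBQ]
    exact trace_diagonal_conj_mul_diagonal_conj _ _ hQ

end
end

section
/- Consider the largest eigenvalue function λ₁ : Sⁿ → ℝ, and let (X, Y) ∈ gph ∂λ₁ with P ∈ Oⁿ(X) ∩ Oⁿ(Y). Let α¹ = {i : λ_i(X) = λ₁(X)}, τ = {i ∈ α¹ : λ_i(Y) > 0}, σ = {i ∈ α¹ : λ_i(Y) = 0}. Then the affine hull of the critical cone of λ₁ at X for Y is aff C_{λ₁}(X, Y) = {H ∈ Sⁿ : P_{α¹}ᵀ H P_{α¹} = [[ρ I_{|τ|}, 0], [0, P_σᵀ H P_σ]] for some ρ ∈ ℝ}. -/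
/- STATEMENT 15: for the largest-eigenvalue function λ₁ on Sⁿ and
(X,Y) ∈ gph ∂λ₁ with P simultaneously ordered-diagonalizing X and Y, the affine
hull of the critical cone is the set of symmetric H such that the top-block
P_{α¹}ᵀ H P_{α¹} has the form [[ρ I_{|τ|}, 0], [0, *]] (τ the indices of α¹
where λ(Y) > 0). -/

open Classical Matrix Filter Topology

noncomputable section

/-- Frobenius inner product. -/
def frob {m : ℕ} (A B : Mat m) : ℝ := (Aᵀ * B).trace

/-- The largest eigenvalue function on Sⁿ (⊤ off the symmetric matrices). -/
def lam1Fn {n : ℕ} [NeZero n] (A : Mat n) : EReal :=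
  if A.IsHermitian then ((eigs A 0 : ℝ) : EReal) else ⊤

def MSubdiff {n : ℕ} (g : Mat n → EReal) (X : Mat n) : Set (Mat n) :=
  {Y | Y.IsHermitian ∧ ∀ Z : Mat n, Z.IsHermitian →
    g X + ((frob Y (Z - X) : ℝ) : EReal) ≤ g Z}

def MSubderiv {n : ℕ} (g : Mat n → EReal) (X H : Mat n) : EReal :=
  Filter.liminf
    (fun q : ℝ × Mat n => (((1 / q.1 : ℝ)) : EReal) * (g (X + q.1 • q.2) - g X))
    ((𝓝[>] (0 : ℝ)) ×ˢ 𝓝 H)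

def MCrit {n : ℕ} (g : Mat n → EReal) (X Y : Mat n) : Set (Mat n) :=
  {H | H.IsHermitian ∧ ((frob Y H : ℝ) : EReal) = MSubderiv g X H}

lemma dotProduct_conj_mulVec {m : ℕ} (Q D : Mat m) (u : Fin m → ℝ) :
    u ⬝ᵥ (Q * D * Qᵀ) *ᵥ u = (Qᵀ *ᵥ u) ⬝ᵥ D *ᵥ (Qᵀ *ᵥ u) := by
  rw [← mulVec_mulVec, ← mulVec_mulVec, dotProduct_mulVec, ← mulVec_transpose]

lemma dotProduct_transpose_mulVec_self {m : ℕ} {Q : Mat m} (hQ : Q * Qᵀ = 1) (u : Fin m → ℝ) :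
    (Qᵀ *ᵥ u) ⬝ᵥ (Qᵀ *ᵥ u) = u ⬝ᵥ u := by
  have := dotProduct_conj_mulVec Q 1 u
  rwa [mul_one, hQ, one_mulVec, one_mulVec, eq_comm] at this

lemma dotProduct_diagonal_mulVec {m : ℕ} (d v : Fin m → ℝ) :
    v ⬝ᵥ diagonal d *ᵥ v = ∑ i, d i * v i ^ 2 := by
  simp only [dotProduct, mulVec_diagonal]
  exact Finset.sum_congr rfl fun i _ => by ring

lemma dotProduct_self_eq_sum_sq {m : ℕ} (v : Fin m → ℝ) : v ⬝ᵥ v = ∑ i, v i ^ 2 :=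
  Finset.sum_congr rfl fun i _ => by ring

lemma dotProduct_self_nonneg_real {m : ℕ} (v : Fin m → ℝ) : 0 ≤ v ⬝ᵥ v := by
  rw [dotProduct_self_eq_sum_sq]; positivity

lemma isHermitian_iff_transpose {m : ℕ} {A : Mat m} : A.IsHermitian ↔ Aᵀ = A := by
  rw [IsHermitian, conjTranspose_eq_transpose_of_trivial]

/-- `eigs` is nonincreasing. -/
lemma eigs_le_eigs_zero {m : ℕ} [NeZero m] (A : Mat m) (i : Fin m) : eigs A i ≤ eigs A 0 := by
  unfold eigs
  split_ifs with h
  · exact Tuple.monotone_sort h.eigenvalues (Fin.rev_le_rev.mpr (Fin.zero_le i))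
  · rfl

lemma eigs_of_isHermitian {m : ℕ} {A : Mat m} (h : A.IsHermitian) :
    eigs A = fun i => h.eigenvalues (Tuple.sort h.eigenvalues i.rev) := dif_pos h

lemma eigenvalues_le_eigs_zero {m : ℕ} [NeZero m] {A : Mat m} (h : A.IsHermitian) (i : Fin m) :
    h.eigenvalues i ≤ eigs A 0 := by
  have := eigs_le_eigs_zero A ((Tuple.sort h.eigenvalues).symm i).rev
  rw [congrFun (eigs_of_isHermitian h)] at this
  simpa only [Fin.rev_rev, Equiv.apply_symm_apply] using this

/-- The Rayleigh bound for the largest eigenvalue. -/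
lemma dotProduct_mulVec_le_eigs_zero {m : ℕ} [NeZero m] {A : Mat m} (h : A.IsHermitian)
    (u : Fin m → ℝ) : u ⬝ᵥ A *ᵥ u ≤ eigs A 0 * (u ⬝ᵥ u) := by
  have hsp := h.spectral_theorem
  rw [Unitary.conjStarAlgAut_apply, star_eq_conjTranspose,
    conjTranspose_eq_transpose_of_trivial] at hsp
  have hU : (h.eigenvectorUnitary : Mat m) * (h.eigenvectorUnitary : Mat m)ᵀ = 1 := by
    have := Unitary.coe_mul_star_self h.eigenvectorUnitary
    rwa [Unitary.coe_star, star_eq_conjTranspose, conjTranspose_eq_transpose_of_trivial] at this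
  have hu := dotProduct_conj_mulVec (h.eigenvectorUnitary : Mat m)
    (diagonal (RCLike.ofReal ∘ h.eigenvalues)) u
  rw [← hsp] at hu
  rw [hu, ← dotProduct_transpose_mulVec_self hU u, dotProduct_diagonal_mulVec,
    dotProduct_self_eq_sum_sq, Finset.mul_sum]
  exact Finset.sum_le_sum fun i _ =>
    mul_le_mul_of_nonneg_right (eigenvalues_le_eigs_zero h i) (sq_nonneg _)

lemma eigs_zero_le {m : ℕ} [NeZero m] {A : Mat m} (h : A.IsHermitian) {c : ℝ}
    (hc : ∀ u : Fin m → ℝ, u ⬝ᵥ A *ᵥ u ≤ c * (u ⬝ᵥ u)) : eigs A 0 ≤ c := by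
  set j := Tuple.sort h.eigenvalues (0 : Fin m).rev
  have he : eigs A 0 = h.eigenvalues j := congrFun (eigs_of_isHermitian h) 0
  have hmul := h.mulVec_eigenvectorBasis j
  have hpos : 0 < (h.eigenvectorBasis j).ofLp ⬝ᵥ (h.eigenvectorBasis j).ofLp := by
    refine lt_of_le_of_ne (dotProduct_self_nonneg_real _) fun h0 => ?_
    have hz := dotProduct_self_eq_zero.mp h0.symm
    exact (h.eigenvectorBasis.orthonormal.ne_zero j) (by ext i; exact congrFun hz i)
  have := hc (h.eigenvectorBasis j).ofLp
  rw [hmul, dotProduct_smul, smul_eq_mul] at this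
  rw [he]
  exact le_of_mul_le_mul_right this hpos

lemma isHermitian_conj {m : ℕ} (Q : Mat m) {A : Mat m} (hA : A.IsHermitian) :
    (Q * A * Qᵀ).IsHermitian := by
  rw [isHermitian_iff_transpose] at *
  simp [transpose_mul, hA, mul_assoc]

lemma isHermitian_transpose_conj {m : ℕ} (Q : Mat m) {A : Mat m} (hA : A.IsHermitian) :
    (Qᵀ * A * Q).IsHermitian := by
  simpa only [transpose_transpose] using isHermitian_conj Qᵀ hA

lemma transpose_conj_conj {m : ℕ} {Q : Mat m} (hQ : Qᵀ * Q = 1) (A : Mat m) :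
    Qᵀ * (Q * A * Qᵀ) * Q = A := by
  rw [mul_assoc, mul_assoc, mul_assoc, hQ, mul_one, ← mul_assoc, hQ, one_mul]

lemma eigs_zero_conj_diagonal_le {m : ℕ} [NeZero m] {Q : Mat m} (hQ : Q * Qᵀ = 1)
    {z : Fin m → ℝ} {c : ℝ} (hz : ∀ i, z i ≤ c) : eigs (Q * diagonal z * Qᵀ) 0 ≤ c := by
  refine eigs_zero_le (isHermitian_conj Q (isHermitian_diagonal z)) fun u => ?_
  rw [dotProduct_conj_mulVec, ← dotProduct_transpose_mulVec_self hQ u, dotProduct_diagonal_mulVec,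
    dotProduct_self_eq_sum_sq, Finset.mul_sum]
  exact Finset.sum_le_sum fun i _ => mul_le_mul_of_nonneg_right (hz i) (sq_nonneg _)

lemma frob_sub {m : ℕ} (W A B : Mat m) : frob W (A - B) = frob W A - frob W B := by
  simp [frob, mul_sub, trace_sub]

lemma frob_vecMulVec {m : ℕ} (w : Fin m → ℝ) (A : Mat m) :
    frob (vecMulVec w w) A = w ⬝ᵥ A *ᵥ w := by
  rw [frob, transpose_vecMulVec, vecMulVec_mul, trace_vecMulVec, dotProduct_comm,
    ← dotProduct_mulVec]

lemma frob_conj_diagonal {m : ℕ} (Q : Mat m) (y : Fin m → ℝ) (A : Mat m) :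
    frob (Q * diagonal y * Qᵀ) A = ∑ i, y i * (Qᵀ * A * Q) i i := by
  rw [frob, transpose_mul, transpose_mul, transpose_transpose, diagonal_transpose, mul_assoc,
    mul_assoc, trace_mul_comm, mul_assoc, mul_assoc, trace]
  simp [diagonal_mul]

/-- Lower bound for the subderivative of `λ₁` by any subgradient. -/
lemma frob_le_MSubderiv {n : ℕ} [NeZero n] {X W : Mat n} (hX : X.IsHermitian)
    (hW : W ∈ MSubdiff lam1Fn X) (H : Mat n) :
    ((frob W H : ℝ) : EReal) ≤ MSubderiv lam1Fn X H := by
  refine EReal.ge_of_forall_gt_iff_ge.mp fun c hc => ?_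
  have hc' : c < frob W H := by exact_mod_cast hc
  have hcont : Continuous fun B : Mat n => frob W B := by
    unfold frob; fun_prop
  refine le_liminf_of_le (by isBoundedDefault) ?_
  have h1 : ∀ᶠ t in 𝓝[>] (0 : ℝ), 0 < t := self_mem_nhdsWithin
  have h2 : ∀ᶠ B in 𝓝 H, c < frob W B := hcont.continuousAt.eventually_const_lt hc'
  filter_upwards [h1.prod_mk h2] with q ⟨hq, hB⟩
  by_cases hZ : (X + q.1 • q.2).IsHermitian
  · have := hW.2 _ hZ
    rw [lam1Fn, lam1Fn, if_pos hX, if_pos hZ, add_sub_cancel_left] at this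
    rw [lam1Fn, lam1Fn, if_pos hX, if_pos hZ]
    norm_cast at this ⊢
    have hs : frob W (q.1 • q.2) = q.1 * frob W q.2 := by simp [frob]
    rw [hs] at this
    rw [one_div, ← div_eq_inv_mul, le_div_iff₀ hq]
    nlinarith
  · rw [lam1Fn, lam1Fn, if_pos hX, if_neg hZ, EReal.top_sub_coe,
      EReal.coe_mul_top_of_pos (by positivity)]
    exact le_top

/-- Upper bound for the subderivative of `λ₁` from a first-order bound along a ray. -/
lemma MSubderiv_le {n : ℕ} [NeZero n] {X H : Mat n} (hX : X.IsHermitian) (hH : H.IsHermitian)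
    {ρ : ℝ} (h : ∀ ε > 0, ∀ᶠ t in 𝓝[>] (0 : ℝ),
      eigs (X + t • H) 0 ≤ eigs X 0 + t * (ρ + ε)) :
    MSubderiv lam1Fn X H ≤ (ρ : ℝ) := by
  refine EReal.le_of_forall_lt_iff_le.mp fun c hc => ?_
  have hc' : ρ < c := by exact_mod_cast hc
  refine liminf_le_of_frequently_le' ?_
  have hmap : Tendsto (fun t : ℝ => (t, H)) (𝓝[>] 0) (𝓝[>] (0 : ℝ) ×ˢ 𝓝 H) :=
    tendsto_id.prodMk tendsto_const_nhds
  refine hmap.frequently (Eventually.frequently ?_)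
  filter_upwards [h (c - ρ) (by linarith), self_mem_nhdsWithin] with t ht ht0
  have hZ : (X + t • H).IsHermitian := by
    rw [isHermitian_iff_transpose] at *
    simp [hX, hH]
  simp only [lam1Fn, if_pos hX, if_pos hZ]
  norm_cast
  have ht0' : 0 < t := ht0
  rw [one_div, ← div_eq_inv_mul, div_le_iff₀ ht0']
  linarith

/-- Subgradients of `λ₁` bound the increase of `λ₁` under simultaneously diagonal perturbations. -/
lemma sum_mul_le_of_mem_MSubdiff {n : ℕ} [NeZero n] {X P : Mat n} {x y : Fin n → ℝ}
    (hP : P * Pᵀ = 1) (hX : X = P * diagonal x * Pᵀ)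
    (hsub : P * diagonal y * Pᵀ ∈ MSubdiff lam1Fn X)
    {z : Fin n → ℝ} {c : ℝ} (hz : ∀ i, x i + z i ≤ c) :
    ∑ i, y i * z i ≤ c - eigs X 0 := by
  have hXh : X.IsHermitian := hX ▸ isHermitian_conj P (isHermitian_diagonal x)
  have hZ := isHermitian_conj P (isHermitian_diagonal (fun i => x i + z i))
  have h := hsub.2 _ hZ
  have hd : P * diagonal (fun i => x i + z i) * Pᵀ - X = P * diagonal z * Pᵀ := by
    rw [hX, ← diagonal_add, mul_add, add_mul, add_sub_cancel_left]
  have hc : Pᵀ * (P * diagonal z * Pᵀ) * P = diagonal z :=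
    transpose_conj_conj (mul_eq_one_comm.mp hP) _
  rw [lam1Fn, lam1Fn, if_pos hXh, if_pos hZ, hd, frob_conj_diagonal, hc] at h
  norm_cast at h
  simp only [diagonal_apply_eq] at h
  linarith [eigs_zero_conj_diagonal_le hP hz]

/-- Eigenvalues of a subgradient of `λ₁`: nonnegative, of sum one, and supported on the indices of
the largest eigenvalue. -/
lemma eigenvalues_of_mem_MSubdiff {n : ℕ} [NeZero n] {X P : Mat n} {y : Fin n → ℝ}
    (hP : P * Pᵀ = 1) (hX : X = P * diagonal (eigs X) * Pᵀ)
    (hsub : P * diagonal y * Pᵀ ∈ MSubdiff lam1Fn X) :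
    (∀ i, 0 ≤ y i) ∧ ∑ i, y i = 1 ∧ ∀ i, eigs X i ≠ eigs X 0 → y i = 0 := by
  have key := fun (z : Fin n → ℝ) (c : ℝ) => sum_mul_le_of_mem_MSubdiff (z := z) (c := c) hP hX hsub
  have hle := eigs_le_eigs_zero X
  have hnn : ∀ i, 0 ≤ y i := fun i => by
    have := key (Pi.single i (-1)) (eigs X 0) fun j => by
      by_cases h : j = i
      · subst h; simp; linarith [hle j]
      · simp [h, hle j]
    simpa [Pi.single_apply] using this
  refine ⟨hnn, ?_, fun i _ => le_antisymm ?_ (hnn i)⟩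
  · have h1 := key (fun _ => 1) (eigs X 0 + 1) fun i => by linarith [hle i]
    have h2 := key (fun _ => -1) (eigs X 0 - 1) fun i => by linarith [hle i]
    simp only [mul_one, mul_neg, Finset.sum_neg_distrib] at h1 h2
    linarith
  · have hlt : 0 < eigs X 0 - eigs X i := sub_pos.mpr (lt_of_le_of_ne (hle i) ‹_›)
    have := key (Pi.single i (eigs X 0 - eigs X i)) (eigs X 0) fun j => by
      by_cases h : j = i
      · subst h; simp
      · simp [h, hle j]
    simp only [Pi.single_apply, mul_ite, mul_zero, Finset.sum_ite_eq', Finset.mem_univ, if_true,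
      sub_self] at this
    exact nonpos_of_mul_nonpos_left this hlt

lemma mulVec_dotProduct_mulVec_mulVec {m : ℕ} (Q A : Mat m) (v : Fin m → ℝ) : (Q *ᵥ v) ⬝ᵥ A *ᵥ (Q *ᵥ v) = v ⬝ᵥ (Qᵀ * A * Q) *ᵥ v := by
  have := dotProduct_conj_mulVec Qᵀ A v
  rw [transpose_transpose] at this
  exact this.symm

/-- Rank-one subgradients of `λ₁`. -/
lemma vecMulVec_mem_MSubdiff {n : ℕ} [NeZero n] {X : Mat n} (hX : X.IsHermitian)
    {w : Fin n → ℝ} (hw : w ⬝ᵥ w = 1) (hXw : w ⬝ᵥ X *ᵥ w = eigs X 0) :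
    vecMulVec w w ∈ MSubdiff lam1Fn X := by
  refine ⟨isHermitian_iff_transpose.mpr (transpose_vecMulVec w w), fun Z hZ => ?_⟩
  rw [lam1Fn, lam1Fn, if_pos hX, if_pos hZ, frob_sub, frob_vecMulVec, frob_vecMulVec, hXw]
  norm_cast
  have := dotProduct_mulVec_le_eigs_zero hZ w
  rw [hw, mul_one] at this
  linarith

lemma quadratic_le_MSubderiv {n : ℕ} [NeZero n] {X P H : Mat n} (hXh : X.IsHermitian)
    (hP : Pᵀ * P = 1) (hX : X = P * diagonal (eigs X) * Pᵀ) {ρ : ℝ}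
    (hρ : MSubderiv lam1Fn X H ≤ (ρ : ℝ)) {v : Fin n → ℝ}
    (hv : ∀ i, eigs X i ≠ eigs X 0 → v i = 0) :
    v ⬝ᵥ (Pᵀ * H * P) *ᵥ v ≤ ρ * (v ⬝ᵥ v) := by
  rcases (dotProduct_self_nonneg_real v).eq_or_lt with h0 | hpos
  · rw [dotProduct_self_eq_zero.mp h0.symm]; simp
  set r := Real.sqrt (v ⬝ᵥ v)
  have hrr : r * r = v ⬝ᵥ v := Real.mul_self_sqrt hpos.le
  set w := P *ᵥ (r⁻¹ • v)
  have hquad : ∀ A : Mat n, w ⬝ᵥ A *ᵥ w = (v ⬝ᵥ v)⁻¹ * (v ⬝ᵥ (Pᵀ * A * P) *ᵥ v) := fun A => by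
    rw [mulVec_dotProduct_mulVec_mulVec, mulVec_smul, smul_dotProduct, dotProduct_smul,
      smul_eq_mul, smul_eq_mul, ← hrr, mul_inv]
    ring
  have hw : w ⬝ᵥ w = 1 := by
    have := hquad 1
    rwa [mul_one, hP, one_mulVec, one_mulVec, inv_mul_cancel₀ hpos.ne'] at this
  have hXw : w ⬝ᵥ X *ᵥ w = eigs X 0 := by
    have hc : Pᵀ * X * P = diagonal (eigs X) := by
      conv_lhs => rw [hX]
      rw [transpose_conj_conj hP]
    have hs : v ⬝ᵥ diagonal (eigs X) *ᵥ v = eigs X 0 * (v ⬝ᵥ v) := by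
      rw [dotProduct_diagonal_mulVec, dotProduct_self_eq_sum_sq, Finset.mul_sum]
      refine Finset.sum_congr rfl fun i _ => ?_
      by_cases h : eigs X i = eigs X 0
      · rw [h]
      · simp [hv i h]
    rw [hquad, hc, hs]
    field_simp
  have h := (frob_le_MSubderiv hXh (vecMulVec_mem_MSubdiff hXh hw hXw) H).trans hρ
  rw [frob_vecMulVec, hquad] at h
  have h' : (v ⬝ᵥ v)⁻¹ * (v ⬝ᵥ (Pᵀ * H * P) *ᵥ v) ≤ ρ := by exact_mod_cast h
  rwa [inv_mul_le_iff₀ hpos, mul_comm] at h'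

lemma exists_two_mul_bilinear_le {m : ℕ} (A : Mat m) :
    ∃ C > 0, ∀ (a b : Fin m → ℝ) (δ : ℝ), 0 < δ →
      2 * (a ⬝ᵥ A *ᵥ b) ≤ C * (δ * (a ⬝ᵥ a) + δ⁻¹ * (b ⬝ᵥ b)) := by
  set K := ∑ i, ∑ j, |A i j| with hK
  have hAK : ∀ i j, |A i j| ≤ K := fun i j =>
    (Finset.single_le_sum (f := fun j => |A i j|) (fun _ _ => abs_nonneg _)
      (Finset.mem_univ j)).trans
    (Finset.single_le_sum (f := fun i => ∑ j, |A i j|)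
      (fun _ _ => Finset.sum_nonneg fun _ _ => abs_nonneg _) (Finset.mem_univ i))
  have hK0 : 0 ≤ K := Finset.sum_nonneg fun _ _ => Finset.sum_nonneg fun _ _ => abs_nonneg _
  refine ⟨m * K + 1, by positivity, fun a b δ hδ => ?_⟩
  have hterm : ∀ i j, 2 * (a i * (A i j * b j)) ≤ K * (δ * a i ^ 2 + δ⁻¹ * b j ^ 2) := by
    intro i j
    have h1 : 2 * (|a i| * |b j|) ≤ δ * a i ^ 2 + δ⁻¹ * b j ^ 2 := by
      have h2 : 0 ≤ δ⁻¹ * (δ * |a i| - |b j|) ^ 2 := by positivity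
      have h3 : δ⁻¹ * (δ * |a i| - |b j|) ^ 2
          = δ * |a i| ^ 2 - 2 * (|a i| * |b j|) + δ⁻¹ * |b j| ^ 2 := by
        field_simp; ring
      rw [h3, sq_abs, sq_abs] at h2
      linarith
    calc 2 * (a i * (A i j * b j)) ≤ |2 * (a i * (A i j * b j))| := le_abs_self _
      _ = |A i j| * (2 * (|a i| * |b j|)) := by
          rw [abs_mul, abs_mul, abs_mul, abs_two]; ring
      _ ≤ K * (δ * a i ^ 2 + δ⁻¹ * b j ^ 2) :=
          mul_le_mul (hAK i j) h1 (by positivity) hK0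
  have hsum : 2 * (a ⬝ᵥ A *ᵥ b) ≤ m * K * (δ * (a ⬝ᵥ a) + δ⁻¹ * (b ⬝ᵥ b)) := by
    calc 2 * (a ⬝ᵥ A *ᵥ b) = ∑ i, ∑ j, 2 * (a i * (A i j * b j)) := by
          simp only [dotProduct, mulVec, Finset.mul_sum]
      _ ≤ ∑ i : Fin m, ∑ j : Fin m, K * (δ * a i ^ 2 + δ⁻¹ * b j ^ 2) :=
          Finset.sum_le_sum fun i _ => Finset.sum_le_sum fun j _ => hterm i j
      _ = m * K * (δ * (a ⬝ᵥ a) + δ⁻¹ * (b ⬝ᵥ b)) := by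
          simp only [dotProduct_self_eq_sum_sq, ← Finset.mul_sum, Finset.sum_add_distrib,
            Finset.sum_const, Finset.card_univ, Fintype.card_fin, nsmul_eq_mul]
          ring
  have : 0 ≤ δ * (a ⬝ᵥ a) + δ⁻¹ * (b ⬝ᵥ b) := by
    have := dotProduct_self_nonneg_real a
    have := dotProduct_self_nonneg_real b
    positivity
  linarith

lemma exists_eigs_gap {n : ℕ} [NeZero n] (X : Mat n) :
    ∃ g > 0, ∀ i, eigs X i ≠ eigs X 0 → eigs X i ≤ eigs X 0 - g := by
  have h : ∀ i, ∀ᶠ g in 𝓝[>] (0 : ℝ), eigs X i ≠ eigs X 0 → eigs X i ≤ eigs X 0 - g := fun i => by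
    by_cases hi : eigs X i = eigs X 0
    · exact Eventually.of_forall fun _ h => (h hi).elim
    have hlt : 0 < eigs X 0 - eigs X i := sub_pos.mpr (lt_of_le_of_ne (eigs_le_eigs_zero X i) hi)
    filter_upwards [Ioo_mem_nhdsGT hlt] with g hg _
    linarith [hg.2]
  obtain ⟨g, hg, hpos⟩ := ((eventually_all.mpr h).and self_mem_nhdsWithin).exists
  exact ⟨g, hpos, hg⟩

/-- The directional derivative of `λ₁` at `X` along `H` is at most any upper bound of the quadratic
form of `H` on the top eigenspace of `X`. -/
lemma MSubderiv_le_of_quadratic_le {n : ℕ} [NeZero n] {X P H : Mat n} (hXh : X.IsHermitian)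
    (hP : P * Pᵀ = 1) (hX : X = P * diagonal (eigs X) * Pᵀ) (hH : H.IsHermitian) {ρ : ℝ}
    (hρ : ∀ v : Fin n → ℝ, (∀ i, eigs X i ≠ eigs X 0 → v i = 0) →
      v ⬝ᵥ (Pᵀ * H * P) *ᵥ v ≤ ρ * (v ⬝ᵥ v)) :
    MSubderiv lam1Fn X H ≤ (ρ : ℝ) := by
  obtain ⟨g, hg, hgap⟩ := exists_eigs_gap X
  set A := Pᵀ * H * P with hA
  have hHA : H = P * A * Pᵀ := by
    rw [hA, ← mul_assoc, ← mul_assoc, hP, one_mul, mul_assoc, hP, mul_one]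
  have hAt : Aᵀ = A := isHermitian_iff_transpose.mp (isHermitian_transpose_conj P hH)
  obtain ⟨C, hC, hbil⟩ := exists_two_mul_bilinear_le A
  refine MSubderiv_le hXh hH fun ε hε => ?_
  set M := C ^ 2 / ε + C + |ρ| with hM
  have hM0 : 0 < M := by positivity
  filter_upwards [Ioo_mem_nhdsGT (div_pos hg hM0)] with t ⟨ht0, ht⟩
  have htM : t * M < g := (lt_div_iff₀ hM0).mp ht
  have hZ : (X + t • H).IsHermitian := by
    rw [isHermitian_iff_transpose] at *
    simp [hXh, hH]
  refine eigs_zero_le hZ fun u => ?_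
  set w := Pᵀ *ᵥ u with hw
  set a : Fin n → ℝ := fun i => if eigs X i = eigs X 0 then w i else 0 with ha
  set b : Fin n → ℝ := fun i => if eigs X i = eigs X 0 then 0 else w i with hb
  have hab : w = a + b := by
    ext i; by_cases h : eigs X i = eigs X 0 <;> simp [ha, hb, h]
  have hnorm : u ⬝ᵥ u = a ⬝ᵥ a + b ⬝ᵥ b := by
    rw [← dotProduct_transpose_mulVec_self hP u, ← hw]
    simp only [dotProduct_self_eq_sum_sq, ← Finset.sum_add_distrib]
    refine Finset.sum_congr rfl fun i _ => ?_
    by_cases h : eigs X i = eigs X 0 <;> simp [ha, hb, h]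
  have hXu : u ⬝ᵥ X *ᵥ u ≤ eigs X 0 * (a ⬝ᵥ a) + (eigs X 0 - g) * (b ⬝ᵥ b) := by
    conv_lhs => rw [hX]
    rw [dotProduct_conj_mulVec, ← hw, dotProduct_diagonal_mulVec]
    simp only [dotProduct_self_eq_sum_sq, Finset.mul_sum, ← Finset.sum_add_distrib]
    refine Finset.sum_le_sum fun i _ => ?_
    by_cases h : eigs X i = eigs X 0
    · simp [ha, hb, h]
    · simpa [ha, hb, h] using mul_le_mul_of_nonneg_right (hgap i h) (sq_nonneg (w i))
  have hHu : u ⬝ᵥ H *ᵥ u = a ⬝ᵥ A *ᵥ a + 2 * (a ⬝ᵥ A *ᵥ b) + b ⬝ᵥ A *ᵥ b := by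
    have hsymm : b ⬝ᵥ A *ᵥ a = a ⬝ᵥ A *ᵥ b := by
      rw [dotProduct_mulVec, ← mulVec_transpose, hAt, dotProduct_comm]
    rw [hHA, dotProduct_conj_mulVec, ← hw, hab, mulVec_add, add_dotProduct, dotProduct_add,
      dotProduct_add, hsymm]
    ring
  have haa : a ⬝ᵥ A *ᵥ a ≤ ρ * (a ⬝ᵥ a) := hρ a fun i h => by simp [ha, h]
  have hcross := hbil a b (ε / C) (by positivity)
  have hbb := hbil b b 1 one_pos
  have hcross' : 2 * (a ⬝ᵥ A *ᵥ b) ≤ ε * (a ⬝ᵥ a) + C ^ 2 / ε * (b ⬝ᵥ b) := by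
    refine hcross.trans_eq ?_
    field_simp
  rw [add_mulVec, smul_mulVec, dotProduct_add, dotProduct_smul, smul_eq_mul, hHu, hnorm]
  have hb0 := dotProduct_self_nonneg_real b
  have hH' : a ⬝ᵥ A *ᵥ a + 2 * (a ⬝ᵥ A *ᵥ b) + b ⬝ᵥ A *ᵥ b
      ≤ (ρ + ε) * (a ⬝ᵥ a) + (C ^ 2 / ε + C) * (b ⬝ᵥ b) := by
    norm_num at hbb
    linarith
  have h1 := mul_le_mul_of_nonneg_left hH' ht0.le
  have h2 : 0 ≤ (g - t * M + t * (|ρ| + ρ + ε)) * (b ⬝ᵥ b) := by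
    have : 0 ≤ |ρ| + ρ := by linarith [neg_abs_le ρ]
    have : 0 ≤ t * (|ρ| + ρ + ε) := by positivity
    exact mul_nonneg (by linarith) hb0
  rw [hM] at h2
  nlinarith

/-- Symmetric matrices `H` for which the block of `Pᵀ H P` on the indices where `x` equals `x 0`
is a multiple of the identity in the rows and columns where `y` is positive. -/
def scalarBlockSubmodule {n : ℕ} [NeZero n] (x y : Fin n → ℝ) (P : Mat n) :
    Submodule ℝ (Mat n) where
  carrier := {H : Mat n | H.IsHermitian ∧ ∃ ρ : ℝ,
    ∀ i j : Fin n, x i = x 0 → x j = x 0 → (0 < y i ∨ 0 < y j) →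
      (Pᵀ * H * P) i j = if i = j then ρ else 0}
  zero_mem' := ⟨isHermitian_zero, 0, fun i j _ _ _ => by simp⟩
  add_mem' := by
    rintro H K ⟨hH, ρ, h⟩ ⟨hK, μ, k⟩
    refine ⟨hH.add hK, ρ + μ, fun i j hi hj hy => ?_⟩
    rw [mul_add, add_mul, Matrix.add_apply, h i j hi hj hy, k i j hi hj hy]
    split_ifs <;> simp
  smul_mem' := by
    rintro c H ⟨hH, ρ, h⟩
    refine ⟨?_, c * ρ, fun i j hi hj hy => ?_⟩
    · rw [isHermitian_iff_transpose] at *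
      simp [hH]
    · rw [mul_smul_comm, smul_mul_assoc, Matrix.smul_apply, h i j hi hj hy]
      split_ifs <;> simp

lemma mem_MCrit_of_quadratic_le {n : ℕ} [NeZero n] {X P H : Mat n} {y : Fin n → ℝ} {ρ : ℝ}
    (hXh : X.IsHermitian) (hP : P * Pᵀ = 1) (hX : X = P * diagonal (eigs X) * Pᵀ)
    (hnn : ∀ i, 0 ≤ y i) (hsum : ∑ i, y i = 1)
    (hsub : P * diagonal y * Pᵀ ∈ MSubdiff lam1Fn X) (hH : H.IsHermitian)
    (hdiag : ∀ i, 0 < y i → (Pᵀ * H * P) i i = ρ)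
    (hquad : ∀ v : Fin n → ℝ, (∀ i, eigs X i ≠ eigs X 0 → v i = 0) →
      v ⬝ᵥ (Pᵀ * H * P) *ᵥ v ≤ ρ * (v ⬝ᵥ v)) :
    H ∈ MCrit lam1Fn X (P * diagonal y * Pᵀ) := by
  have hfrob : frob (P * diagonal y * Pᵀ) H = ρ := by
    rw [frob_conj_diagonal, ← one_mul ρ, ← hsum, Finset.sum_mul]
    refine Finset.sum_congr rfl fun i _ => ?_
    rcases (hnn i).eq_or_lt with h | h
    · simp [← h]
    · rw [hdiag i h]
  refine ⟨hH, le_antisymm (frob_le_MSubderiv hXh hsub H) ?_⟩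
  rw [hfrob]
  exact MSubderiv_le_of_quadratic_le hXh hP hX hH hquad

/-- The critical cone of `λ₁` consists of matrices with the scalar block structure. -/
lemma scalar_block_of_mem_MCrit {n : ℕ} [NeZero n] {X P H : Mat n} {y : Fin n → ℝ}
    (hXh : X.IsHermitian) (hP : Pᵀ * P = 1) (hX : X = P * diagonal (eigs X) * Pᵀ)
    (hnn : ∀ i, 0 ≤ y i) (hsum : ∑ i, y i = 1) (hsupp : ∀ i, eigs X i ≠ eigs X 0 → y i = 0)
    (hH : H ∈ MCrit lam1Fn X (P * diagonal y * Pᵀ)) :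
    H ∈ scalarBlockSubmodule (eigs X) y P := by
  obtain ⟨hHh, hcrit⟩ := hH
  set ρ := frob (P * diagonal y * Pᵀ) H with hρ
  rw [frob_conj_diagonal] at hρ
  set A := Pᵀ * H * P with hA
  have hAsymm : ∀ i j, A j i = A i j := fun i j =>
    congrFun (congrFun (isHermitian_iff_transpose.mp (isHermitian_transpose_conj P hHh)) i) j
  have hquad : ∀ v : Fin n → ℝ, (∀ i, eigs X i ≠ eigs X 0 → v i = 0) →
      v ⬝ᵥ A *ᵥ v ≤ ρ * (v ⬝ᵥ v) := fun v hv =>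
    quadratic_le_MSubderiv hXh hP hX hcrit.ge hv
  have hpair : ∀ i j, eigs X i = eigs X 0 → eigs X j = eigs X 0 → i ≠ j → ∀ s : ℝ,
      A i i + 2 * s * A i j + s ^ 2 * A j j ≤ ρ * (1 + s ^ 2) := by
    intro i j hi hj hij s
    have h := hquad (Pi.single i 1 + s • Pi.single j 1) fun k hk => by
      have h1 : k ≠ i := by rintro rfl; exact hk hi
      have h2 : k ≠ j := by rintro rfl; exact hk hj
      simp [h1, h2]
    simp only [mulVec_add, mulVec_smul, mulVec_single_one, add_dotProduct, dotProduct_add,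
      smul_dotProduct, dotProduct_smul, single_one_dotProduct, col_apply, smul_eq_mul,
      Pi.single_eq_same, Pi.single_eq_of_ne hij, Pi.single_eq_of_ne hij.symm, hAsymm i j] at h
    linarith
  have hle : ∀ i, eigs X i = eigs X 0 → A i i ≤ ρ := fun i hi => by
    simpa using hquad (Pi.single i 1) fun k hk => by
      have h1 : k ≠ i := by rintro rfl; exact hk hi
      simp [h1]
  have hpos : ∀ i, 0 < y i → eigs X i = eigs X 0 := fun i hi =>
    by_contra fun h => hi.ne' (hsupp i h)
  have hdiag : ∀ i, 0 < y i → A i i = ρ := by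
    have hzero : ∑ i, y i * (ρ - A i i) = 0 := by
      simp only [mul_sub, Finset.sum_sub_distrib, ← Finset.sum_mul, hsum, ← hρ, one_mul, sub_self]
    have hterm : ∀ i ∈ Finset.univ, 0 ≤ y i * (ρ - A i i) := fun i _ => by
      rcases (hnn i).eq_or_lt with h | h
      · simp [← h]
      · exact mul_nonneg h.le (sub_nonneg.mpr (hle i (hpos i h)))
    intro i hi
    have := (Finset.sum_eq_zero_iff_of_nonneg hterm).mp hzero i (Finset.mem_univ i)
    rcases mul_eq_zero.mp this with h | h
    · exact absurd h hi.ne'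
    · linarith
  have hoff : ∀ i j, 0 < y i → eigs X j = eigs X 0 → i ≠ j → A i j = 0 := by
    intro i j hi hj hij
    have hD := hle j hj
    have h := hpair i j (hpos i hi) hj hij (A i j / (ρ - A j j + 1))
    rw [hdiag i hi] at h
    have hden : 0 < ρ - A j j + 1 := by linarith
    set r := A i j / (ρ - A j j + 1)
    have hr : A i j = r * (ρ - A j j + 1) := (div_mul_cancel₀ _ hden.ne').symm
    have hr0 : r ^ 2 * (ρ - A j j + 2) ≤ 0 := by rw [hr] at h; linarith
    have : r = 0 := by
      by_contra hne
      have : 0 < r ^ 2 * (ρ - A j j + 2) := mul_pos (by positivity) (by linarith)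
      linarith
    rw [hr, this, zero_mul]
  refine ⟨hHh, ρ, fun i j hi hj hy => ?_⟩
  split_ifs with hij
  · subst hij
    exact hdiag i (hy.elim id id)
  · rcases hy with h | h
    · exact hoff i j h hj hij
    · exact (hAsymm j i).trans (hoff j i h hi (Ne.symm hij))

/-- Shifting the scalar block upwards makes its scalar dominate the whole block. -/
lemma exists_quadratic_add_diagonal_le {n : ℕ} [NeZero n] {A : Mat n} {x y : Fin n → ℝ} {ρ : ℝ}
    (hsupp : ∀ i, x i ≠ x 0 → y i = 0) (hA : A.IsHermitian)
    (hblock : ∀ i j, x i = x 0 → x j = x 0 → (0 < y i ∨ 0 < y j) →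
      A i j = if i = j then ρ else 0) :
    ∃ s, 0 ≤ s ∧ ∀ v : Fin n → ℝ, (∀ i, x i ≠ x 0 → v i = 0) →
      v ⬝ᵥ (A + diagonal fun i => if 0 < y i then s else 0) *ᵥ v ≤ (ρ + s) * (v ⬝ᵥ v) := by
  obtain ⟨C, hC, hbil⟩ := exists_two_mul_bilinear_le A
  refine ⟨C + |ρ|, by positivity, fun v hv => ?_⟩
  set s := C + |ρ| with hs
  set p : Fin n → ℝ := fun i => if 0 < y i then v i else 0 with hp
  set q : Fin n → ℝ := fun i => if 0 < y i then 0 else v i with hq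
  have hpq : v = p + q := by
    ext i; by_cases h : 0 < y i <;> simp [hp, hq, h]
  have hortho : q ⬝ᵥ p = 0 :=
    Finset.sum_eq_zero fun i _ => by by_cases h : 0 < y i <;> simp [hp, hq, h]
  have hAp : ∀ i, x i = x 0 → (A *ᵥ p) i = ρ * p i := by
    intro i hi
    rw [mulVec, dotProduct, Finset.sum_eq_single i]
    · by_cases h : 0 < y i
      · rw [hblock i i hi hi (Or.inl h), if_pos rfl]
      · simp [hp, h]
    · intro j _ hji
      by_cases h : 0 < y j
      · have hj : x j = x 0 := by_contra fun hj => h.ne' (hsupp j hj)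
        rw [hblock i j hi hj (Or.inr h), if_neg (Ne.symm hji), zero_mul]
      · simp [hp, h]
    · exact fun h => absurd (Finset.mem_univ i) h
  have hvAp : ∀ u : Fin n → ℝ, (∀ i, x i ≠ x 0 → u i = 0) → u ⬝ᵥ A *ᵥ p = ρ * (u ⬝ᵥ p) := by
    intro u hu
    simp only [dotProduct, Finset.mul_sum]
    refine Finset.sum_congr rfl fun i _ => ?_
    by_cases hi : x i = x 0
    · rw [hAp i hi]; ring
    · simp [hu i hi]
  have hpp := hvAp p fun i hi => by simp [hp, hv i hi]
  have hqp := hvAp q fun i hi => by simp [hq, hv i hi]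
  have hsymm : p ⬝ᵥ A *ᵥ q = q ⬝ᵥ A *ᵥ p := by
    rw [dotProduct_mulVec, ← mulVec_transpose, isHermitian_iff_transpose.mp hA, dotProduct_comm]
  have hqq := hbil q q 1 one_pos
  have hdiag : v ⬝ᵥ (diagonal fun i => if 0 < y i then s else 0) *ᵥ v = s * (p ⬝ᵥ p) := by
    rw [dotProduct_diagonal_mulVec, dotProduct_self_eq_sum_sq, Finset.mul_sum]
    refine Finset.sum_congr rfl fun i _ => ?_
    by_cases h : 0 < y i <;> simp [hp, h]
  have hvv : v ⬝ᵥ v = p ⬝ᵥ p + q ⬝ᵥ q := by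
    rw [hpq, add_dotProduct, dotProduct_add, dotProduct_add, dotProduct_comm p q, hortho]
    ring
  have hvA : v ⬝ᵥ A *ᵥ v = ρ * (p ⬝ᵥ p) + q ⬝ᵥ A *ᵥ q := by
    conv_lhs => rw [hpq]
    rw [mulVec_add, add_dotProduct, dotProduct_add, dotProduct_add, hsymm, hpp, hqp, hortho]
    ring
  rw [add_mulVec, dotProduct_add, hdiag, hvA, hvv]
  have hq0 : 0 ≤ (|ρ| + ρ) * (q ⬝ᵥ q) :=
    mul_nonneg (by linarith [neg_abs_le ρ]) (dotProduct_self_nonneg_real q)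
  norm_num at hqq
  rw [hs]
  linarith

theorem statement15 {n : ℕ} [NeZero n] (X Y P : Mat n)
    (hX : X.IsHermitian) (hY : Y.IsHermitian)
    (hP : Pᵀ * P = 1)
    (hXd : X = P * Matrix.diagonal (eigs X) * Pᵀ)
    (hYd : Y = P * Matrix.diagonal (eigs Y) * Pᵀ)
    (hsub : Y ∈ MSubdiff lam1Fn X) :
    ((affineSpan ℝ (MCrit lam1Fn X Y) : AffineSubspace ℝ (Mat n)) : Set (Mat n)) =
      {H : Mat n | H.IsHermitian ∧ ∃ ρ : ℝ,
        ∀ i j : Fin n, eigs X i = eigs X 0 → eigs X j = eigs X 0 →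
          (0 < eigs Y i ∨ 0 < eigs Y j) →
          (Pᵀ * H * P) i j = if i = j then ρ else 0} := by
  set y := eigs Y
  have hP' : P * Pᵀ = 1 := mul_eq_one_comm.mp hP
  rw [hYd] at hsub ⊢
  obtain ⟨hnn, hsum, hsupp⟩ := eigenvalues_of_mem_MSubdiff hP' hXd hsub
  refine Set.Subset.antisymm ?_ ?_
  · have hle : affineSpan ℝ (MCrit lam1Fn X (P * diagonal y * Pᵀ)) ≤
        (scalarBlockSubmodule (eigs X) y P).toAffineSubspace :=
      affineSpan_le.mpr fun H hH => scalar_block_of_mem_MCrit hX hP hXd hnn hsum hsupp hH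
    exact hle
  · rintro H ⟨hH, ρ, hblock⟩
    obtain ⟨s, hs, hquad⟩ := exists_quadratic_add_diagonal_le hsupp
      (isHermitian_transpose_conj P hH) hblock
    set d : Fin n → ℝ := fun i => if 0 < y i then s else 0 with hd
    set D := P * diagonal d * Pᵀ with hD
    have hDh : D.IsHermitian := isHermitian_conj P (isHermitian_diagonal d)
    have hDA : Pᵀ * D * P = diagonal d := transpose_conj_conj hP _
    have hDcrit : D ∈ MCrit lam1Fn X (P * diagonal y * Pᵀ) := by
      refine mem_MCrit_of_quadratic_le hX hP' hXd hnn hsum hsub hDh (ρ := s) ?_ ?_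
      · intro i hi
        simp [hDA, hd, hi]
      · intro v _
        rw [hDA, dotProduct_diagonal_mulVec, dotProduct_self_eq_sum_sq, Finset.mul_sum]
        refine Finset.sum_le_sum fun i _ => mul_le_mul_of_nonneg_right ?_ (sq_nonneg _)
        simp only [hd]
        split_ifs
        exacts [le_rfl, hs]
    have hHDA : Pᵀ * (H + D) * P = Pᵀ * H * P + diagonal d := by rw [mul_add, add_mul, hDA]
    have hHDcrit : H + D ∈ MCrit lam1Fn X (P * diagonal y * Pᵀ) := by
      refine mem_MCrit_of_quadratic_le hX hP' hXd hnn hsum hsub (hH.add hDh) (ρ := ρ + s) ?_ ?_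
      · intro i hi
        have hi0 : eigs X i = eigs X 0 := by_contra fun h => hi.ne' (hsupp i h)
        simp [hHDA, hblock i i hi0 hi0 (Or.inl hi), hd, hi]
      · rwa [hHDA]
    have h0crit : (0 : Mat n) ∈ MCrit lam1Fn X (P * diagonal y * Pᵀ) :=
      mem_MCrit_of_quadratic_le hX hP' hXd hnn hsum hsub isHermitian_zero (ρ := 0)
        (fun i _ => by simp) (fun v _ => by simp)
    have := AffineSubspace.smul_vsub_vadd_mem _ (1 : ℝ) (mem_affineSpan ℝ hHDcrit)
      (mem_affineSpan ℝ hDcrit) (mem_affineSpan ℝ h0crit)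
    simpa using this

end
end
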